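/- arXiv:2307.11372 — 6 statements merged into one kernel-verified Lean document; each statement's English description precedes it below -/
import Mathlib

section
/- Every support-preserving multiplicative map Φ : 𝒫 → 𝒫 extends to a map Ψ : ℳ → ℳ that is multiplicative (Ψ[p·q] = Ψ[p]·Ψ[q] for all p, q ∈ ℳ), degree-preserving (deg Ψ[q] = deg q for all q ∈ ℳ), and satisfies Ψ[p] = Φ[p] for all p ∈ 𝒫; moreover any multiplicative map ℳ → ℳ extending Φ equals Ψ. -/
open Polynomial

/-- `Pset` is the set of real polynomials with nonnegative coefficients summing to 1. -/
def Pset : Set (Polynomial ℝ) := {p | (∀ k, 0 ≤ p.coeff k) ∧ p.eval 1 = 1}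

/-- `Mset` is the set of real polynomials `p` with `p(1) = 1` that are positive on the
positive reals. -/
def Mset : Set (Polynomial ℝ) := {p | p.eval 1 = 1 ∧ ∀ x : ℝ, 0 < x → 0 < p.eval x}


lemma mul_mem_Pset {p q : ℝ[X]} (hp : p ∈ Pset) (hq : q ∈ Pset) : p * q ∈ Pset := by
  refine ⟨fun k => ?_, by rw [eval_mul, hp.2, hq.2, one_mul]⟩
  rw [coeff_mul]
  exact Finset.sum_nonneg fun i _ => mul_nonneg (hp.1 _) (hq.1 _)

lemma pow_mem_Pset {p : ℝ[X]} (hp : p ∈ Pset) (n : ℕ) : p ^ n ∈ Pset := by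
  induction n with
  | zero =>
    refine ⟨fun k => ?_, by simp⟩
    rw [pow_zero, coeff_one]
    split_ifs <;> norm_num
  | succ n ih => rw [pow_succ]; exact mul_mem_Pset ih hp

lemma ne_zero_of_mem_Pset {p : ℝ[X]} (hp : p ∈ Pset) : p ≠ 0 := by
  rintro rfl
  simpa using hp.2

lemma Pset_subset_Mset : Pset ⊆ Mset := by
  refine fun p hp => ⟨hp.2, fun x hx => ?_⟩
  rw [eval_eq_sum, sum]
  refine Finset.sum_pos (fun i hi => ?_) (nonempty_support_iff.2 (ne_zero_of_mem_Pset hp))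
  exact mul_pos (lt_of_le_of_ne (hp.1 i) (mem_support_iff.1 hi).symm) (pow_pos hx i)

lemma mul_mem_Mset {p q : ℝ[X]} (hp : p ∈ Mset) (hq : q ∈ Mset) : p * q ∈ Mset :=
  ⟨by rw [eval_mul, hp.1, hq.1, one_mul],
    fun x hx => by rw [eval_mul]; exact mul_pos (hp.2 x hx) (hq.2 x hx)⟩

/-- A definite binary quadratic form dominates linear terms on the line `s + t = M`, `M` large. -/
lemma quadratic_form_ge_linear {b c : ℝ} (h : b ^ 2 < 4 * c) :
    ∃ M₀ : ℝ, ∀ s t : ℝ, 0 ≤ s → 0 ≤ t → M₀ ≤ s + t →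
      0 ≤ s * (s - 1) - b * s * t + c * t * (t - 1) := by
  have hc : 0 < c := by nlinarith [sq_nonneg b]
  obtain ⟨δ, hδ, hδ1, hdisc⟩ : ∃ δ : ℝ, 0 < δ ∧ δ < 1 ∧ b ^ 2 / 4 ≤ (1 - δ) * (c - δ) := by
    have e : (4 * c - b ^ 2) / (4 * (1 + c)) * (1 + c) = c - b ^ 2 / 4 := by field_simp
    refine ⟨(4 * c - b ^ 2) / (4 * (1 + c)), div_pos (by linarith) (by linarith), ?_, ?_⟩
    · rw [div_lt_one (by linarith)]
      nlinarith [sq_nonneg b]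
    · nlinarith [sq_nonneg ((4 * c - b ^ 2) / (4 * (1 + c)))]
  refine ⟨2 * (1 + c) / δ, fun s t hs ht hM => ?_⟩
  have hform : δ * (s ^ 2 + t ^ 2) ≤ s ^ 2 - b * s * t + c * t ^ 2 := by
    have h1 : 0 ≤ (1 - δ) * ((s ^ 2 - b * s * t + c * t ^ 2) - δ * (s ^ 2 + t ^ 2)) := by
      have e : (1 - δ) * ((s ^ 2 - b * s * t + c * t ^ 2) - δ * (s ^ 2 + t ^ 2)) =
          ((1 - δ) * s - b * t / 2) ^ 2 + ((1 - δ) * (c - δ) - b ^ 2 / 4) * t ^ 2 := by ring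
      rw [e]
      exact add_nonneg (sq_nonneg _) (mul_nonneg (by linarith) (sq_nonneg t))
    linarith [nonneg_of_mul_nonneg_right h1 (by linarith)]
  rw [div_le_iff₀ hδ] at hM
  have hst : 0 ≤ (s + t) * ((s + t) * δ - 2 * (1 + c)) :=
    mul_nonneg (by linarith) (by linarith)
  nlinarith [mul_nonneg hδ.le (sq_nonneg (s - t)), mul_nonneg hc.le hs]

lemma exists_X_add_one_pow_mul_quadratic_coeff_nonneg {b c : ℝ} (h : b ^ 2 < 4 * c) :
    ∃ N : ℕ, ∀ k, 0 ≤ ((X + 1) ^ N * (X ^ 2 - C b * X + C c) : ℝ[X]).coeff k := by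
  have hc : 0 < c := by nlinarith [sq_nonneg b]
  obtain ⟨M₀, hM⟩ := quadratic_form_ge_linear h
  obtain ⟨N, hN⟩ := exists_nat_ge (max M₀ (b / c))
  have hN₀ : M₀ ≤ N := (le_max_left _ _).trans hN
  have hN₁ : b ≤ N * c := (div_le_iff₀ hc).1 ((le_max_right _ _).trans hN)
  have e : ((X + 1) ^ N * (X ^ 2 - C b * X + C c) : ℝ[X]) =
      (X + 1) ^ N * X ^ 2 - C b * ((X + 1) ^ N * X) + C c * (X + 1) ^ N := by ring
  refine ⟨N, fun k => ?_⟩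
  rw [e, coeff_add, coeff_sub, coeff_C_mul, coeff_C_mul]
  match k with
  | 0 => simp [coeff_X_add_one_pow, hc.le]
  | 1 =>
    rw [coeff_mul_X_pow', if_neg (by norm_num), coeff_mul_X, coeff_X_add_one_pow,
      coeff_X_add_one_pow, Nat.choose_zero_right, Nat.choose_one_right]
    push_cast
    linarith
  | k + 2 =>
    rw [coeff_mul_X_pow, coeff_mul_X, coeff_X_add_one_pow, coeff_X_add_one_pow,
      coeff_X_add_one_pow]
    rcases le_or_gt N k with hk | hk
    · rw [Nat.choose_eq_zero_of_lt (show N < k + 1 by omega),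
        Nat.choose_eq_zero_of_lt (show N < k + 2 by omega)]
      simp
    obtain ⟨m, rfl⟩ := Nat.exists_eq_add_of_lt hk
    have h1 := Nat.choose_succ_right_eq (k + m + 1) k
    have h2 := Nat.choose_succ_right_eq (k + m + 1) (k + 1)
    rw [show k + m + 1 - k = m + 1 by omega] at h1
    rw [show k + m + 1 - (k + 1) = m by omega] at h2
    have h1' : ((k + m + 1).choose (k + 1) : ℝ) * (k + 1) = (k + m + 1).choose k * (m + 1) := by
      exact_mod_cast h1
    have h2' : ((k + m + 1).choose (k + 2) : ℝ) * (k + 2) =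
        (k + m + 1).choose (k + 1) * m := by exact_mod_cast h2
    have key := hM (k + 2) (m + 1) (by positivity) (by positivity)
      (by push_cast at hN₀; linarith)
    generalize ((k + m + 1).choose k : ℝ) = x at *
    generalize ((k + m + 1).choose (k + 2) : ℝ) = z at *
    have hy : (0 : ℝ) ≤ (k + m + 1).choose (k + 1) := Nat.cast_nonneg _
    generalize ((k + m + 1).choose (k + 1) : ℝ) = y at *
    have hpos : (0 : ℝ) < (m + 1) * (k + 2) := by positivity
    refine nonneg_of_mul_nonneg_right (a := ((m : ℝ) + 1) * (k + 2)) ?_ hpos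
    have e2 : ((m : ℝ) + 1) * (k + 2) * (x - b * y + c * z) =
        y * ((k + 2) * (k + 2 - 1) - b * (k + 2) * (m + 1) + c * (m + 1) * (m + 1 - 1)) := by
      linear_combination (-(k + 2 : ℝ)) * h1' + c * (m + 1) * h2'
    rw [e2]
    exact mul_nonneg hy key

lemma exists_X_add_one_pow_mul_coeff_nonneg (q : ℝ[X]) (hq : ∀ x : ℝ, 0 < x → 0 < q.eval x) :
    ∃ N : ℕ, ∀ k, 0 ≤ ((X + 1) ^ N * q).coeff k := by
  induction hn : q.natDegree using Nat.strong_induction_on generalizing q with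
  | _ n ih =>
  subst hn
  have step (g h : ℝ[X]) (e : q = g * h) (hg : 0 < g.natDegree)
      (hgpos : ∀ x : ℝ, 0 < x → 0 < g.eval x)
      (hgN : ∃ N : ℕ, ∀ k, 0 ≤ ((X + 1) ^ N * g).coeff k) :
      ∃ N : ℕ, ∀ k, 0 ≤ ((X + 1) ^ N * q).coeff k := by
    have hh : ∀ x : ℝ, 0 < x → 0 < h.eval x := fun x hx => by
      have := hq x hx
      rw [e, eval_mul] at this
      exact (pos_iff_pos_of_mul_pos this).1 (hgpos x hx)
    have hg0 : g ≠ 0 := ne_zero_of_natDegree_gt hg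
    have hh0 : h ≠ 0 := by rintro rfl; simpa using hh 1 one_pos
    obtain ⟨N, hN⟩ := hgN
    obtain ⟨M, hM⟩ := ih h.natDegree (by rw [e, natDegree_mul hg0 hh0]; omega) h hh rfl
    refine ⟨N + M, fun k => ?_⟩
    rw [e, show (X + 1) ^ (N + M) * (g * h) = ((X + 1) ^ N * g) * ((X + 1) ^ M * h) by ring,
      coeff_mul]
    exact Finset.sum_nonneg fun i _ => mul_nonneg (hN _) (hM _)
  rcases Nat.eq_zero_or_pos q.natDegree with h0 | h0
  · refine ⟨0, fun k => ?_⟩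
    have h1 := hq 1 one_pos
    rw [eq_C_of_natDegree_eq_zero h0] at h1 ⊢
    rw [eval_C] at h1
    rw [pow_zero, one_mul, coeff_C]
    split_ifs
    exacts [h1.le, le_rfl]
  obtain ⟨z, hz⟩ := IsAlgClosed.exists_aeval_eq_zero ℂ q
    (by rw [degree_eq_natDegree (ne_zero_of_natDegree_gt h0)]; exact_mod_cast h0.ne')
  by_cases him : z.im = 0
  · have hzr : z = (z.re : ℂ) := Complex.ext rfl (by simpa using him)
    have hroot : q.eval z.re = 0 := by
      rw [hzr, ← Complex.coe_algebraMap, aeval_algebraMap_apply] at hz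
      simpa using hz
    have hre : z.re ≤ 0 := not_lt.1 fun h => (hq _ h).ne' hroot
    obtain ⟨h, e⟩ := dvd_iff_isRoot.2 hroot
    refine step _ h e (by simp) (fun x hx => by simp; linarith) ⟨0, fun k => ?_⟩
    rw [pow_zero, one_mul, coeff_sub, coeff_X, coeff_C]
    split_ifs <;> linarith
  · obtain ⟨h, e⟩ := quadratic_dvd_of_aeval_eq_zero_im_ne_zero q hz him
    have hn : ‖z‖ ^ 2 = z.re ^ 2 + z.im ^ 2 := by
      rw [Complex.sq_norm, Complex.normSq_apply]; ring
    have him2 : 0 < z.im ^ 2 := by positivity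
    refine step _ h e ?_ (fun x _ => ?_) ?_
    · have : (X ^ 2 - C (2 * z.re) * X + C (‖z‖ ^ 2) : ℝ[X]).natDegree = 2 := by compute_degree!
      omega
    · simp only [eval_add, eval_sub, eval_pow, eval_X, eval_mul, eval_C, hn]
      nlinarith [sq_nonneg (x - z.re)]
    · exact exists_X_add_one_pow_mul_quadratic_coeff_nonneg (by rw [hn]; nlinarith)

/-- The normalized linear polynomial `(x + a) / (1 + a)`. -/
noncomputable def linearPoly (a : ℝ) : ℝ[X] := C (1 + a)⁻¹ * (X + C a)

lemma linearPoly_mem {a : ℝ} (ha : 0 < a) : linearPoly a ∈ Pset := by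
  refine ⟨fun k => ?_, by simp [linearPoly]; field_simp⟩
  rw [linearPoly, coeff_C_mul, coeff_add, coeff_X, coeff_C]
  refine mul_nonneg (by positivity) ?_
  split_ifs <;> linarith

/-- Poincaré's theorem, a univariate case of Pólya's Positivstellensatz. -/
lemma exists_linearPoly_pow_mul_mem {q : ℝ[X]} (hq : q ∈ Mset) {a : ℝ} (ha : 0 < a) :
    ∃ N : ℕ, linearPoly a ^ N * q ∈ Pset := by
  obtain ⟨N, hN⟩ := exists_X_add_one_pow_mul_coeff_nonneg (q.comp (C a * X)) (fun x hx => by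
    simpa using hq.2 (a * x) (mul_pos ha hx))
  refine ⟨N, fun k => ?_, by rw [eval_mul, (pow_mem_Pset (linearPoly_mem ha) N).2, hq.1, one_mul]⟩
  have e : linearPoly a ^ N * q =
      C (((1 + a)⁻¹ * a) ^ N) * ((X + 1) ^ N * q.comp (C a * X)).comp (C a⁻¹ * X) := by
    have hX : (C a * X : ℝ[X]).comp (C a⁻¹ * X) = X := by
      rw [mul_comp, C_comp, X_comp, ← mul_assoc, ← C_mul, mul_inv_cancel₀ ha.ne', C_1, one_mul]
    have hl : linearPoly a = C ((1 + a)⁻¹ * a) * (C a⁻¹ * X + 1) := by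
      have : (C a * C a⁻¹ : ℝ[X]) = 1 := by rw [← C_mul, mul_inv_cancel₀ ha.ne', C_1]
      rw [linearPoly, C_mul]
      linear_combination (-(C (1 + a)⁻¹ * X)) * this
    rw [mul_comp, comp_assoc, hX, comp_X, pow_comp, add_comp, X_comp, one_comp, hl, mul_pow, C_pow,
      mul_assoc]
  rw [e, coeff_C_mul, comp_C_mul_X_coeff]
  exact mul_nonneg (by positivity) (mul_nonneg (hN k) (by positivity))

section SupportPreserving

variable {Φ : ℝ[X] → ℝ[X]}

lemma support_eq_of_supportPreserving (hmap : ∀ p ∈ Pset, Φ p ∈ Pset)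
    (hsupp : ∀ p ∈ Pset, ∀ k : ℕ, 0 < (Φ p).coeff k ↔ 0 < p.coeff k) {p : ℝ[X]} (hp : p ∈ Pset) :
    (Φ p).support = p.support := by
  ext k
  rw [mem_support_iff, mem_support_iff, ← ((hmap p hp).1 k).lt_iff_ne', hsupp p hp,
    (hp.1 k).lt_iff_ne']

lemma isCoprime_map_linearPoly (hmap : ∀ p ∈ Pset, Φ p ∈ Pset)
    (hsupp : ∀ p ∈ Pset, ∀ k : ℕ, 0 < (Φ p).coeff k ↔ 0 < p.coeff k)
    (hmul : ∀ p ∈ Pset, ∀ q ∈ Pset, Φ (p * q) = Φ p * Φ q) :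
    IsCoprime (Φ (linearPoly 1)) (Φ (linearPoly 2)) := by
  have form {a : ℝ} (ha : 0 < a) :
      ∃ v, Φ (linearPoly a) = C (1 - v) * X + C v := by
    have hd : (Φ (linearPoly a)).degree ≤ 1 := by
      rw [degree, support_eq_of_supportPreserving hmap hsupp (linearPoly_mem ha), ← degree,
        linearPoly]
      compute_degree
    have e := eq_X_add_C_of_degree_le_one hd
    have h1 := (hmap _ (linearPoly_mem ha)).2
    rw [e] at h1
    simp only [eval_add, eval_mul, eval_C, eval_X, mul_one] at h1
    exact ⟨_, by rw [← h1, add_sub_cancel_right]; exact e⟩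
  have h1 := linearPoly_mem one_pos
  have h2 := linearPoly_mem two_pos
  have hne : Φ (linearPoly 1) ≠ Φ (linearPoly 2) := by
    intro heq
    -- The cofactor `q = (x² - x + 2) / 2` has sparse products with both linear polynomials.
    let p₁ : ℝ[X] := C (1 / 4) * (X ^ 3 + X + C 2)
    let p₂ : ℝ[X] := C (1 / 6) * (X ^ 3 + X ^ 2 + C 4)
    have hp₁ : p₁ ∈ Pset := by
      refine ⟨fun k => ?_, by simp [p₁]; norm_num⟩
      simp only [p₁, coeff_C_mul, coeff_add, coeff_X_pow, coeff_X, coeff_C]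
      split_ifs <;> norm_num
    have hp₂ : p₂ ∈ Pset := by
      refine ⟨fun k => ?_, by simp [p₂]; norm_num⟩
      simp only [p₂, coeff_C_mul, coeff_add, coeff_X_pow, coeff_C]
      split_ifs <;> norm_num
    have hprod : linearPoly 2 * p₁ = linearPoly 1 * p₂ := by
      apply Polynomial.funext
      intro x
      simp only [linearPoly, p₁, p₂, eval_mul, eval_add, eval_pow, eval_X, eval_C]
      ring
    have hΦ : Φ p₁ = Φ p₂ := by
      refine mul_left_cancel₀ (ne_zero_of_mem_Pset (hmap _ h2)) ?_
      rw [← hmul _ h2 _ hp₁, hprod, hmul _ h1 _ hp₂, heq]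
    have hc := hsupp p₁ hp₁ 1
    rw [hΦ, hsupp p₂ hp₂ 1] at hc
    simp [p₁, p₂, coeff_X, coeff_X_pow] at hc
  obtain ⟨v, hv⟩ := form one_pos
  obtain ⟨w, hw⟩ := form two_pos
  rw [hv, hw] at hne ⊢
  have hvw : v - w ≠ 0 := fun h => hne (by rw [sub_eq_zero.1 h])
  refine ⟨C ((1 - w) / (v - w)), C (-(1 - v) / (v - w)), ?_⟩
  apply Polynomial.funext
  intro x
  simp only [eval_mul, eval_add, eval_X, eval_C, eval_one]
  field_simp
  ring

lemma exists_quotient (hmap : ∀ p ∈ Pset, Φ p ∈ Pset)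
    (hsupp : ∀ p ∈ Pset, ∀ k : ℕ, 0 < (Φ p).coeff k ↔ 0 < p.coeff k)
    (hmul : ∀ p ∈ Pset, ∀ q ∈ Pset, Φ (p * q) = Φ p * Φ q) {q : ℝ[X]} (hq : q ∈ Mset) :
    ∃ r : ℝ[X], ∀ p ∈ Pset, p * q ∈ Pset → Φ (p * q) = Φ p * r := by
  have hpow {p : ℝ[X]} (hp : p ∈ Pset) (n : ℕ) : Φ (p ^ n) ∣ Φ p ^ (n + 1) := by
    induction n with
    | zero =>
      have := hmul p hp (p ^ 0) (pow_mem_Pset hp 0)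
      rw [pow_zero, mul_one] at this
      rw [pow_zero, zero_add, pow_one]
      exact Dvd.intro_left _ this.symm
    | succ n ih =>
      rw [pow_succ p, hmul _ (pow_mem_Pset hp n) _ hp, pow_succ]
      exact mul_dvd_mul_right ih _
  have hcross {p p' : ℝ[X]} (hp : p ∈ Pset) (hp' : p' ∈ Pset) (hpq : p * q ∈ Pset)
      (hpq' : p' * q ∈ Pset) : Φ p' * Φ (p * q) = Φ p * Φ (p' * q) := by
    rw [← hmul _ hp' _ hpq, ← hmul _ hp _ hpq', mul_left_comm]
  obtain ⟨N, hN⟩ := exists_linearPoly_pow_mul_mem hq one_pos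
  obtain ⟨M, hM⟩ := exists_linearPoly_pow_mul_mem hq two_pos
  have hp₁ := pow_mem_Pset (linearPoly_mem one_pos) N
  have hp₂ := pow_mem_Pset (linearPoly_mem two_pos) M
  have hcop : IsCoprime (Φ (linearPoly 1 ^ N)) (Φ (linearPoly 2 ^ M)) :=
    ((isCoprime_map_linearPoly hmap hsupp hmul).pow.of_isCoprime_of_dvd_left
      (hpow (linearPoly_mem one_pos) N)).of_isCoprime_of_dvd_right (hpow (linearPoly_mem two_pos) M)
  obtain ⟨r, hr⟩ := hcop.dvd_of_dvd_mul_left (Dvd.intro _ (hcross hp₁ hp₂ hN hM).symm)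
  refine ⟨r, fun p hp hpq => mul_left_cancel₀ (ne_zero_of_mem_Pset (hmap _ hp₁)) ?_⟩
  rw [hcross hp hp₁ hpq hN, hr, mul_left_comm]

end SupportPreserving

theorem stmt_7 (Φ : Polynomial ℝ → Polynomial ℝ)
    (hmap : ∀ p ∈ Pset, Φ p ∈ Pset)
    (hsupp : ∀ p ∈ Pset, ∀ k : ℕ, 0 < (Φ p).coeff k ↔ 0 < p.coeff k)
    (hmul : ∀ p ∈ Pset, ∀ q ∈ Pset, Φ (p * q) = Φ p * Φ q) :
    ∃ Ψ : Polynomial ℝ → Polynomial ℝ,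
      (∀ q ∈ Mset, Ψ q ∈ Mset) ∧
      (∀ p ∈ Mset, ∀ q ∈ Mset, Ψ (p * q) = Ψ p * Ψ q) ∧
      (∀ q ∈ Mset, (Ψ q).degree = q.degree) ∧
      (∀ p ∈ Pset, Ψ p = Φ p) ∧
      (∀ Ψ' : Polynomial ℝ → Polynomial ℝ,
        (∀ q ∈ Mset, Ψ' q ∈ Mset) →
        (∀ p ∈ Mset, ∀ q ∈ Mset, Ψ' (p * q) = Ψ' p * Ψ' q) →
        (∀ p ∈ Pset, Ψ' p = Φ p) →
        ∀ q ∈ Mset, Ψ' q = Ψ q) := by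
  classical
  choose! Ψ hΨ using fun q (hq : q ∈ Mset) => exists_quotient hmap hsupp hmul hq
  have hmult (q : ℝ[X]) (hq : q ∈ Mset) : ∃ p ∈ Pset, p * q ∈ Pset :=
    (exists_linearPoly_pow_mul_mem hq one_pos).imp' _ fun N hN =>
      ⟨pow_mem_Pset (linearPoly_mem one_pos) N, hN⟩
  refine ⟨Ψ, fun q hq => ?_, fun q hq q' hq' => ?_, fun q hq => ?_, fun p hp => ?_,
    fun Ψ' _ hmul' hext q hq => ?_⟩
  · obtain ⟨p, hp, hpq⟩ := hmult q hq
    have e := hΨ q hq p hp hpq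
    have hm := Pset_subset_Mset (hmap _ hpq)
    have hm' := Pset_subset_Mset (hmap _ hp)
    rw [e] at hm
    refine ⟨?_, fun x hx => ?_⟩
    · simpa [eval_mul, hm'.1] using hm.1
    · have := hm.2 x hx
      rw [eval_mul] at this
      exact (pos_iff_pos_of_mul_pos this).1 (hm'.2 x hx)
  · obtain ⟨p, hp, hpq⟩ := hmult q hq
    obtain ⟨p', hp', hpq'⟩ := hmult q' hq'
    have e : p * p' * (q * q') = (p * q) * (p' * q') := by ring
    have h := hΨ (q * q') (mul_mem_Mset hq hq') (p * p') (mul_mem_Pset hp hp')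
      (e ▸ mul_mem_Pset hpq hpq')
    rw [e, hmul _ hpq _ hpq', hmul _ hp _ hp', hΨ q hq p hp hpq, hΨ q' hq' p' hp' hpq'] at h
    refine mul_left_cancel₀ (mul_ne_zero (ne_zero_of_mem_Pset (hmap _ hp))
      (ne_zero_of_mem_Pset (hmap _ hp'))) ?_
    rw [← h]
    ring
  · obtain ⟨p, hp, hpq⟩ := hmult q hq
    have hdeg {p : ℝ[X]} (hp : p ∈ Pset) : (Φ p).degree = p.degree := by
      rw [degree, support_eq_of_supportPreserving hmap hsupp hp, degree]
    have e := hdeg hpq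
    rw [hΨ q hq p hp hpq, degree_mul, degree_mul, hdeg hp,
      degree_eq_natDegree (ne_zero_of_mem_Pset hp)] at e
    exact (WithBot.add_left_inj WithBot.coe_ne_bot).1 e
  · exact mul_left_cancel₀ (ne_zero_of_mem_Pset (hmap _ hp))
      ((hΨ p (Pset_subset_Mset hp) p hp (mul_mem_Pset hp hp)).symm.trans (hmul p hp p hp))
  · obtain ⟨p, hp, hpq⟩ := hmult q hq
    refine mul_left_cancel₀ (ne_zero_of_mem_Pset (hmap _ hp)) ?_
    rw [← hΨ q hq p hp hpq, ← hext _ hpq, hmul' p (Pset_subset_Mset hp) q hq, hext p hp]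
end

section
/- Let Φ : 𝒫 → 𝒫 be a support-preserving multiplicative map. Then for all real a, b > 0 with a ≠ b, Φ[(X+a)/(1+a)] ≠ Φ[(X+b)/(1+b)]. -/
open Polynomial

/-- The normalized linear polynomial `(X + a)/(1 + a)`. -/
noncomputable def lin (a : ℝ) : Polynomial ℝ := C (1 + a)⁻¹ * (X + C a)

lemma lin_mem_Pset {a : ℝ} (ha : 0 < a) : lin a ∈ Pset := by
  have h : 0 < 1 + a := by linarith
  refine ⟨fun k => ?_, ?_⟩
  · rw [lin, coeff_C_mul, coeff_add, coeff_X, coeff_C]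
    refine mul_nonneg (inv_nonneg.2 h.le) (add_nonneg ?_ ?_) <;> split_ifs <;> linarith
  · simp only [lin, eval_mul, eval_C, eval_add, eval_X]
    exact inv_mul_cancel₀ h.ne'

/-- The product of `lin a` and the monic quadratic `X ^ 2 - t X + c`, normalized at `1`. -/
noncomputable def linMulQuadratic (t c a : ℝ) : ℝ[X] :=
  lin a * (C (1 - t + c)⁻¹ * (X ^ 2 - C t * X + C c))

lemma linMulQuadratic_eq (t c a : ℝ) :
    linMulQuadratic t c a = C ((1 + a)⁻¹ * (1 - t + c)⁻¹) *
      (C 1 * X ^ 3 + C (a - t) * X ^ 2 + C (c - a * t) * X + C (a * c)) := by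
  simp only [linMulQuadratic, lin, C_mul, C_sub, C_1]
  ring

lemma coeff_two_linMulQuadratic (t c a : ℝ) :
    (linMulQuadratic t c a).coeff 2 = (1 + a)⁻¹ * (1 - t + c)⁻¹ * (a - t) := by
  rw [linMulQuadratic_eq, coeff_C_mul]
  simp only [coeff_add, coeff_C_mul, coeff_X_pow, coeff_X, coeff_C]
  norm_num

lemma linMulQuadratic_mem_Pset {t c a : ℝ} (ha : 0 < a) (hta : t ≤ a) (hc : a * t ≤ c)
    (hc0 : 0 ≤ c) (hs : 0 < 1 - t + c) : linMulQuadratic t c a ∈ Pset := by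
  have h : 0 < 1 + a := by linarith
  refine ⟨fun k => ?_, ?_⟩
  · rw [linMulQuadratic_eq, coeff_C_mul]
    refine mul_nonneg (by positivity) ?_
    simp only [coeff_add, coeff_C_mul, coeff_X_pow, coeff_X, coeff_C]
    have := mul_nonneg ha.le hc0
    refine add_nonneg (add_nonneg (add_nonneg ?_ ?_) ?_) ?_ <;> split_ifs <;> linarith
  · have hl := (lin_mem_Pset ha).2
    simp only [linMulQuadratic, eval_mul, hl, eval_C, eval_add, eval_sub, eval_pow, eval_X]
    rw [one_mul, one_pow, mul_one, inv_mul_cancel₀ hs.ne']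

lemma map_lin_ne_of_lt (Φ : ℝ[X] → ℝ[X])
    (hmap : ∀ p ∈ Pset, Φ p ∈ Pset)
    (hsupp : ∀ p ∈ Pset, ∀ k : ℕ, 0 < (Φ p).coeff k ↔ 0 < p.coeff k)
    (hmul : ∀ p ∈ Pset, ∀ q ∈ Pset, Φ (p * q) = Φ p * Φ q)
    {a b : ℝ} (ha : 0 < a) (hab : a < b) : Φ (lin a) ≠ Φ (lin b) := by
  intro heq
  have hb : 0 < b := ha.trans hab
  obtain ⟨c, hc⟩ : ∃ c, c = a * b + a ^ 2 + 1 := ⟨_, rfl⟩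
  have hmab : 0 < a * b := mul_pos ha hb
  have hs : 0 < 1 - a + c := by nlinarith [sq_nonneg (a - 1)]
  have hP : linMulQuadratic a c a ∈ Pset :=
    linMulQuadratic_mem_Pset ha le_rfl (by nlinarith) (by nlinarith) hs
  have hQ : linMulQuadratic a c b ∈ Pset :=
    linMulQuadratic_mem_Pset hb hab.le (by nlinarith) (by nlinarith) hs
  have hcomm : linMulQuadratic a c a * lin b = linMulQuadratic a c b * lin a := by
    simp only [linMulQuadratic]
    ring
  have hΦ : Φ (linMulQuadratic a c a) = Φ (linMulQuadratic a c b) := by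
    have h := congrArg Φ hcomm
    rw [hmul _ hP _ (lin_mem_Pset hb), hmul _ hQ _ (lin_mem_Pset ha), heq] at h
    exact mul_right_cancel₀ (ne_zero_of_mem_Pset (hmap _ (lin_mem_Pset hb))) h
  have hpos : 0 < (linMulQuadratic a c b).coeff 2 := by
    rw [coeff_two_linMulQuadratic]
    have := sub_pos.2 hab
    positivity
  rw [← hsupp _ hQ, ← hΦ, hsupp _ hP, coeff_two_linMulQuadratic, sub_self, mul_zero] at hpos
  exact lt_irrefl _ hpos

theorem stmt_8 (Φ : Polynomial ℝ → Polynomial ℝ)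
    (hmap : ∀ p ∈ Pset, Φ p ∈ Pset)
    (hsupp : ∀ p ∈ Pset, ∀ k : ℕ, 0 < (Φ p).coeff k ↔ 0 < p.coeff k)
    (hmul : ∀ p ∈ Pset, ∀ q ∈ Pset, Φ (p * q) = Φ p * Φ q)
    (a b : ℝ) (ha : 0 < a) (hb : 0 < b) (hab : a ≠ b) :
    Φ (lin a) ≠ Φ (lin b) := by
  rcases hab.lt_or_gt with h | h
  · exact map_lin_ne_of_lt Φ hmap hsupp hmul ha h
  · exact (map_lin_ne_of_lt Φ hmap hsupp hmul hb h).symm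
end

section
/- Let Φ : 𝒫 → 𝒫 be a support-preserving multiplicative map, and let 0 < a < b be reals. If Φ[(X+a)/(1+a)] = (X+a')/(1+a') and Φ[(X+b)/(1+b)] = (X+b')/(1+b') for some reals a', b' > 0, then a' < b'. -/
open Polynomial

theorem coeff_lin_mul_succ (t : ℝ) (p : Polynomial ℝ) (k : ℕ) :
    (lin t * p).coeff (k + 1) = (1 + t)⁻¹ * (p.coeff k + t * p.coeff (k + 1)) := by
  rw [lin, mul_assoc, coeff_C_mul, add_mul, coeff_add, coeff_X_mul, coeff_C_mul]

theorem lin_mem_Pset_s10 {t : ℝ} (ht : 0 < t) : lin t ∈ Pset := by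
  refine ⟨fun k => ?_, ?_⟩
  · rw [lin, coeff_C_mul, coeff_add, coeff_X, coeff_C]
    positivity
  · have : 1 + t ≠ 0 := by positivity
    simp [lin, this]

/-- The cubic with coefficients proportional to `1, u, v, w`, scaled by `s`. -/
noncomputable def scaledCubic (s u v w : ℝ) : Polynomial ℝ :=
  C s * (X ^ 3 + C u * X ^ 2 + C v * X + C w)

theorem coeff_scaledCubic (s u v w : ℝ) (k : ℕ) :
    (scaledCubic s u v w).coeff k =
      s * ((if k = 3 then 1 else 0) + u * (if k = 2 then 1 else 0) +
        v * (if 1 = k then 1 else 0) + if k = 0 then w else 0) := by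
  simp only [scaledCubic, coeff_C_mul, coeff_add, coeff_X_pow, coeff_X, coeff_C]

theorem scaledCubic_mem_Pset {s u v w : ℝ} (hs : 0 ≤ s) (hu : 0 ≤ u) (hv : 0 ≤ v) (hw : 0 ≤ w)
    (hsum : s * (1 + u + v + w) = 1) : scaledCubic s u v w ∈ Pset := by
  refine ⟨fun k => ?_, ?_⟩
  · rw [coeff_scaledCubic]
    positivity
  · simpa [scaledCubic] using hsum

theorem stmt_10 (Φ : Polynomial ℝ → Polynomial ℝ)
    (hmap : ∀ p ∈ Pset, Φ p ∈ Pset)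
    (hsupp : ∀ p ∈ Pset, ∀ k : ℕ, 0 < (Φ p).coeff k ↔ 0 < p.coeff k)
    (hmul : ∀ p ∈ Pset, ∀ q ∈ Pset, Φ (p * q) = Φ p * Φ q)
    (a b a' b' : ℝ) (ha : 0 < a) (hab : a < b)
    (ha' : 0 < a') (hb' : 0 < b')
    (hΦa : Φ (lin a) = lin a') (hΦb : Φ (lin b) = lin b') :
    a' < b' := by
  have hb : 0 < b := ha.trans hab
  have hd : 0 < b - a := sub_pos.2 hab
  have hm : 0 < 1 - a + a * b := by nlinarith [sq_nonneg (a - 1), mul_pos ha hd]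
  have ha1 : 0 < 1 + a := by positivity
  have hb1 : 0 < 1 + b := by positivity
  -- Both cubics are multiples of `X ^ 2 - a X + a b`, by `X + a` and `X + b` respectively.
  set A := scaledCubic ((1 + a)⁻¹ * (1 - a + a * b)⁻¹) 0 (a * (b - a)) (a ^ 2 * b) with hA
  set B := scaledCubic ((1 + b)⁻¹ * (1 - a + a * b)⁻¹) (b - a) 0 (a * b ^ 2) with hB
  have hAP : A ∈ Pset := by
    refine scaledCubic_mem_Pset (by positivity) le_rfl (by positivity) (by positivity) ?_
    rw [show 1 + 0 + a * (b - a) + a ^ 2 * b = (1 + a) * (1 - a + a * b) by ring, ← mul_inv,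
      inv_mul_cancel₀ (by positivity)]
  have hBP : B ∈ Pset := by
    refine scaledCubic_mem_Pset (by positivity) hd.le le_rfl (by positivity) ?_
    rw [show 1 + (b - a) + 0 + a * b ^ 2 = (1 + b) * (1 - a + a * b) by ring, ← mul_inv,
      inv_mul_cancel₀ (by positivity)]
  have hprod : lin b * A = lin a * B := by
    simp only [hA, hB, scaledCubic, lin, C_mul, C_sub, C_pow, C_0]
    ring
  have hΦ : lin b' * Φ A = lin a' * Φ B := by
    rw [← hΦa, ← hΦb, ← hmul _ (lin_mem_Pset_s10 hb) _ hAP, ← hmul _ (lin_mem_Pset_s10 ha) _ hBP, hprod]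
  have hzero : ∀ p ∈ Pset, ∀ k, p.coeff k = 0 → (Φ p).coeff k = 0 := fun p hp k hk =>
    le_antisymm (not_lt.1 fun h => ((hsupp p hp k).1 h).ne' hk) ((hmap p hp).1 k)
  have hA2 : (Φ A).coeff 2 = 0 := hzero A hAP 2 (by simp [hA, coeff_scaledCubic])
  have hA4 : (Φ A).coeff 4 = 0 := hzero A hAP 4 (by simp [hA, coeff_scaledCubic])
  have hB4 : (Φ B).coeff 4 = 0 := hzero B hBP 4 (by simp [hB, coeff_scaledCubic])
  have hA3 : 0 < (Φ A).coeff 3 := (hsupp A hAP 3).2 (by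
    rw [hA, coeff_scaledCubic]; norm_num; positivity)
  have hB2 : 0 < (Φ B).coeff 2 := (hsupp B hBP 2).2 (by
    rw [hB, coeff_scaledCubic]; norm_num; positivity)
  have h4 := congrArg (coeff · (3 + 1)) hΦ
  have h3 := congrArg (coeff · (2 + 1)) hΦ
  simp only [coeff_lin_mul_succ, Nat.reduceAdd, hA2, hA4, hB4, mul_zero, add_zero, zero_add]
    at h3 h4
  have hgap : (b' - a') * ((1 + b')⁻¹ * (Φ A).coeff 3) = (1 + a')⁻¹ * (Φ B).coeff 2 := by
    linear_combination h3 - a' * h4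
  have hpos : 0 < (b' - a') * ((1 + b')⁻¹ * (Φ A).coeff 3) := by
    rw [hgap]
    positivity
  exact sub_pos.1 (pos_of_mul_pos_left hpos (by positivity))
end

section
/- Let f be a real-valued function on the positive reals, taking positive values, that is strictly monotone increasing on (0,∞) and satisfies f(2x) = 2f(x) and f(3x) = 3f(x) for all x > 0. Then there exists a constant c > 0 such that f(x) = c·x for all x > 0. -/
/-- The ratio `log 2 / log 3` is irrational. -/
theorem irrational_log_two_div_log_three : Irrational (Real.log 2 / Real.log 3) := by
  rintro ⟨q, hq⟩
  have hlog2 : 0 < Real.log 2 := Real.log_pos (by norm_num)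
  have hlog3 : 0 < Real.log 3 := Real.log_pos (by norm_num)
  have hq0 : 0 < q := by
    have : (0 : ℝ) < q := hq ▸ div_pos hlog2 hlog3
    exact_mod_cast this
  have hnum : ((q.num.toNat : ℕ) : ℤ) = q.num := Int.toNat_of_nonneg (Rat.num_pos.2 hq0).le
  have hden : (q.den : ℝ) ≠ 0 := by exact_mod_cast q.den_nz
  have hlog : (q.den : ℝ) * Real.log 2 = (q.num.toNat : ℝ) * Real.log 3 := by
    have hcast : (q : ℝ) = (q.num.toNat : ℝ) / q.den := by
      rw [Rat.cast_def]
      congr 1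
      exact_mod_cast hnum.symm
    rw [hcast] at hq
    field_simp at hq
    linarith
  have hpow : (2 : ℝ) ^ q.den = 3 ^ q.num.toNat := by
    apply Real.log_injOn_pos (Set.mem_Ioi.2 (by positivity)) (Set.mem_Ioi.2 (by positivity))
    rw [Real.log_pow, Real.log_pow, hlog]
  have hnat : 2 ^ q.den = 3 ^ q.num.toNat := by exact_mod_cast hpow
  have heven : Even (3 ^ q.num.toNat) := hnat ▸ (even_two.pow_of_ne_zero q.den_nz)
  exact Nat.not_even_iff_odd.2 (Odd.pow (by decide)) heven

/-- The numbers `2 ^ m * 3 ^ n` with `m n : ℤ` are dense in the positive reals. -/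
theorem exists_two_zpow_mul_three_zpow_between {a b : ℝ} (ha : 0 < a) (hab : a < b) :
    ∃ m n : ℤ, a < 2 ^ m * 3 ^ n ∧ (2 : ℝ) ^ m * 3 ^ n < b := by
  have hdense := dense_addSubgroupClosure_pair_iff.2 irrational_log_two_div_log_three
  obtain ⟨z, hz, haz, hzb⟩ := hdense.exists_between (Real.log_lt_log ha hab)
  obtain ⟨m, n, rfl⟩ := AddSubgroup.mem_closure_pair.1 hz
  have hlog : m • Real.log 2 + n • Real.log 3 = Real.log (2 ^ m * 3 ^ n) := by
    rw [Real.log_mul (by positivity) (by positivity), Real.log_zpow, Real.log_zpow,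
      zsmul_eq_mul, zsmul_eq_mul]
  rw [hlog] at haz hzb
  exact ⟨m, n, (Real.log_lt_log_iff ha (by positivity)).1 haz,
    (Real.log_lt_log_iff (by positivity) (ha.trans hab)).1 hzb⟩

/-- Homogeneity with respect to `c > 0` on the positive reals extends to integer powers of `c`. -/
theorem map_zpow_mul_of_map_mul {f : ℝ → ℝ} {c : ℝ} (hc : 0 < c)
    (h : ∀ x : ℝ, 0 < x → f (c * x) = c * f x) (m : ℤ) {x : ℝ} (hx : 0 < x) :
    f (c ^ m * x) = c ^ m * f x := by
  have hsucc (k : ℤ) : f (c ^ (k + 1) * x) = c * f (c ^ k * x) := by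
    rw [← h _ (by positivity), zpow_add_one₀ hc.ne']
    ring_nf
  induction m using Int.induction_on with
  | zero => simp
  | succ k ih => rw [hsucc, ih, zpow_add_one₀ hc.ne']; ring
  | pred k ih =>
    have hk := hsucc (-k - 1)
    rw [sub_add_cancel, ih] at hk
    rw [zpow_sub_one₀ hc.ne'] at hk ⊢
    field_simp at hk ⊢
    linarith

theorem stmt_11 (f : ℝ → ℝ)
    (hpos : ∀ x : ℝ, 0 < x → 0 < f x)
    (hmono : ∀ x y : ℝ, 0 < x → x < y → f x < f y)
    (h2 : ∀ x : ℝ, 0 < x → f (2 * x) = 2 * f x)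
    (h3 : ∀ x : ℝ, 0 < x → f (3 * x) = 3 * f x) :
    ∃ c : ℝ, 0 < c ∧ ∀ x : ℝ, 0 < x → f x = c * x := by
  have hle (x y : ℝ) (hx : 0 < x) (hy : 0 < y) : f x * y ≤ f y * x := by
    by_contra! hlt
    have hfy := hpos y hy
    obtain ⟨m, n, hl, hr⟩ := exists_two_zpow_mul_three_zpow_between (div_pos hx hy)
      (show x / y < f x / f y by rw [div_lt_div_iff₀ hy hfy]; linarith)
    rw [div_lt_iff₀ hy] at hl
    rw [lt_div_iff₀ hfy] at hr
    have hf := hmono _ _ hx hl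
    rw [mul_assoc, map_zpow_mul_of_map_mul two_pos h2 m (by positivity),
      map_zpow_mul_of_map_mul three_pos h3 n hy, ← mul_assoc] at hf
    exact hf.not_gt hr
  refine ⟨f 1, hpos 1 one_pos, fun x hx => ?_⟩
  linarith [hle x 1 hx one_pos, hle 1 x one_pos hx]
end

section
/- Let Ψ : ℳ → ℳ be multiplicative and degree-preserving, with Ψ[p] ∈ 𝒫 for every p ∈ 𝒫, and suppose the restriction of Ψ to 𝒫 is support-preserving and that Ψ[(X+1)/2] = (X+1)/2. Then for every a ∈ (−2,2) and every real γ > 0, Ψ[(X²−aγX+γ²)/(1−aγ+γ²)] = (X²−aγX+γ²)/(1−aγ+γ²). -/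
open Polynomial

/-- All coefficients of `p` are nonnegative. -/
def NonnegCoeffs (p : ℝ[X]) : Prop := ∀ k, 0 ≤ p.coeff k

namespace NonnegCoeffs

variable {p q : ℝ[X]}

protected theorem add (hp : NonnegCoeffs p) (hq : NonnegCoeffs q) : NonnegCoeffs (p + q) := fun k => by
  rw [coeff_add]
  exact add_nonneg (hp k) (hq k)

protected theorem mul (hp : NonnegCoeffs p) (hq : NonnegCoeffs q) : NonnegCoeffs (p * q) := fun k => by
  rw [coeff_mul]
  exact Finset.sum_nonneg fun x _ => mul_nonneg (hp x.1) (hq x.2)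

protected theorem C {c : ℝ} (hc : 0 ≤ c) : NonnegCoeffs (Polynomial.C c) := fun k => by
  rw [coeff_C]
  split_ifs <;> simp [hc]

protected theorem X : NonnegCoeffs (Polynomial.X : ℝ[X]) := fun k => by
  rw [coeff_X]
  split_ifs <;> simp

protected theorem pow (hp : NonnegCoeffs p) (n : ℕ) : NonnegCoeffs (p ^ n) := by
  induction n with
  | zero => simpa using NonnegCoeffs.C zero_le_one
  | succ n ih => simpa [pow_succ] using ih.mul hp

protected theorem expand (hp : NonnegCoeffs p) {n : ℕ} (hn : 0 < n) :
    NonnegCoeffs (Polynomial.expand ℝ n p) := fun k => by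
  rw [coeff_expand hn]
  split_ifs
  exacts [hp _, le_rfl]

protected theorem comp (hp : NonnegCoeffs p) (hq : NonnegCoeffs q) : NonnegCoeffs (p.comp q) := fun k => by
  rw [Polynomial.comp, eval₂_eq_sum, Polynomial.sum, finsetSum_coeff]
  exact Finset.sum_nonneg fun i _ => ((NonnegCoeffs.C (hp i)).mul (hq.pow i)) k

end NonnegCoeffs

theorem choose_add_choose_ge {b : ℝ} (hb : -2 ≤ b) {N : ℕ} (hN : 4 ≤ (2 - b) * (N + 2)) (k : ℕ) :
    b * N.choose (k + 1) ≤ N.choose k + N.choose (k + 2) := by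
  rcases lt_or_ge N (k + 1) with h | h
  · rw [Nat.choose_eq_zero_of_lt h]
    simp only [Nat.cast_zero, mul_zero]
    positivity
  obtain ⟨j, rfl⟩ := Nat.exists_eq_add_of_le h
  have h₁ := Nat.choose_succ_right_eq (k + 1 + j) k
  have h₂ := Nat.choose_succ_right_eq (k + 1 + j) (k + 1)
  rw [show k + 1 + j - k = j + 1 by omega] at h₁
  rw [show k + 1 + j - (k + 1) = j by omega] at h₂
  have hB : (0 : ℝ) ≤ ((k + 1 + j).choose (k + 1) : ℝ) := Nat.cast_nonneg _
  replace h₁ := congrArg (Nat.cast : ℕ → ℝ) h₁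
  replace h₂ := congrArg (Nat.cast : ℕ → ℝ) h₂
  push_cast at h₁ h₂ hN
  set A : ℝ := ((k + 1 + j).choose k : ℝ)
  set B : ℝ := ((k + 1 + j).choose (k + 1) : ℝ)
  set D : ℝ := ((k + 1 + j).choose (k + 2) : ℝ)
  have hk : (0 : ℝ) ≤ k := Nat.cast_nonneg _
  have hj : (0 : ℝ) ≤ j := Nat.cast_nonneg _
  have key : b * ((j + 1) * (k + 2)) ≤ (k + 1) * (k + 2) + j * (j + 1) := by
    nlinarith [mul_nonneg (by linarith : (0 : ℝ) ≤ 2 + b) (sq_nonneg ((k : ℝ) + 2 - (j + 1))),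
      mul_nonneg (sub_nonneg.2 hN) (by linarith : (0 : ℝ) ≤ k + 1 + j + 2)]
  have hpos : (0 : ℝ) < (j + 1) * (k + 2) := by positivity
  have h₃ := mul_le_mul_of_nonneg_right key hB
  refine le_of_mul_le_mul_right ?_ hpos
  linear_combination h₃ + (k + 2 : ℝ) * h₁ - (j + 1 : ℝ) * h₂

/-- A quadratic instance of Pólya's theorem on forms positive on the simplex. -/
theorem exists_nonnegCoeffs_mul_X_add_one_pow {b : ℝ} (hb : -2 ≤ b) (hb' : b < 2) :
    ∃ N : ℕ, NonnegCoeffs ((X ^ 2 - C b * X + C 1) * (X + C 1) ^ N) := by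
  obtain ⟨N, hN⟩ := exists_nat_ge (4 / (2 - b))
  rw [div_le_iff₀ (by linarith)] at hN
  have hN' : 4 ≤ (2 - b) * (N + 2) := by linarith
  refine ⟨N, fun k => ?_⟩
  have hsplit : (X ^ 2 - C b * X + C 1) * (X + C 1) ^ N =
      (X + C 1) ^ N * X ^ 2 - C b * ((X + C 1) ^ N * X) + (X + C 1) ^ N := by
    rw [C_1]; ring
  rw [hsplit, coeff_add, coeff_sub, coeff_C_mul]
  rcases k with _ | _ | k
  · simp [coeff_zero_eq_eval_zero]
  · have : (0 : ℝ) ≤ N := Nat.cast_nonneg _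
    rw [coeff_mul_X_pow']
    simp [coeff_X_add_one_pow]
    nlinarith
  · rw [coeff_mul_X_pow, coeff_mul_X]
    simp only [C_1, coeff_X_add_one_pow]
    linarith [choose_add_choose_ge hb hN' k]

/-- A nonnegative additive function on the positive reals that fixes `1` is the identity. -/
theorem eq_self_of_additive_nonneg {f : ℝ → ℝ} (h0 : ∀ b, 0 < b → 0 ≤ f b)
    (hadd : ∀ b c, 0 < b → 0 < c → f (b + c) = f b + f c) (h1 : f 1 = 1) {x : ℝ} (hx : 0 < x) :
    f x = x := by
  have hmul : ∀ y, 0 < y → ∀ n : ℕ, f ((n + 1) * y) = (n + 1) * f y := fun y hy n => by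
    induction n with
    | zero => simp
    | succ n ih =>
      rw [show ((n + 1 : ℕ) + 1 : ℝ) * y = (n + 1) * y + y by push_cast; ring,
        hadd _ _ (by positivity) hy, ih]
      push_cast; ring
  have hmono : ∀ y z, 0 < y → y < z → f y ≤ f z := fun y z hy hyz => by
    have := hadd y (z - y) hy (by linarith)
    rw [add_sub_cancel] at this
    linarith [h0 (z - y) (by linarith)]
  have hnat : ∀ n : ℕ, f (n + 1) = n + 1 := fun n => by
    simpa [h1] using hmul 1 one_pos n
  have hupper : ∀ y, 0 < y → f y ≤ y + 1 := fun y hy => by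
    have := hmono y _ hy (Nat.lt_floor_add_one y)
    rw [hnat] at this
    linarith [Nat.floor_le hy.le]
  have hlower : ∀ y, 0 < y → y - 1 ≤ f y := fun y hy => by
    rcases le_or_gt y 1 with h | h
    · linarith [h0 y hy]
    obtain ⟨n, hn⟩ := Nat.exists_eq_add_of_le' (Nat.floor_pos.2 h.le)
    have hle := Nat.floor_le hy.le
    have hlt := Nat.lt_floor_add_one y
    rw [hn] at hle hlt
    push_cast at hle hlt
    rcases hle.eq_or_lt with h' | h'
    · rw [← h', hnat]; linarith
    · linarith [hmono _ _ (by positivity) h', hnat n]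
  by_contra hne
  obtain ⟨n, hn⟩ := exists_nat_gt (1 / |f x - x|)
  rw [div_lt_iff₀ (abs_pos.2 (sub_ne_zero.2 hne))] at hn
  have hx' : (0 : ℝ) < (n + 1) * x := by positivity
  have hu := hupper _ hx'
  have hl := hlower _ hx'
  rw [hmul x hx] at hu hl
  have h₁ : |(n + 1) * (f x - x)| ≤ 1 := abs_le.2 ⟨by linarith, by linarith⟩
  rw [abs_mul, abs_of_pos (by positivity : (0 : ℝ) < n + 1)] at h₁
  nlinarith [abs_nonneg (f x - x)]

/-- The monic quadratic `X² + uX + v`. -/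
noncomputable def monicQuadratic (u v : ℝ) : ℝ[X] := X ^ 2 + C u * X + C v

namespace monicQuadratic

variable (u v : ℝ)

theorem eq_quadratic : monicQuadratic u v = C 1 * X ^ 2 + C u * X + C v := by
  simp [monicQuadratic]

@[simp]
theorem natDegree_eq : (monicQuadratic u v).natDegree = 2 := by
  rw [eq_quadratic, natDegree_quadratic one_ne_zero]

theorem monic : (monicQuadratic u v).Monic := by
  rw [Monic, eq_quadratic, leadingCoeff_quadratic one_ne_zero]

@[simp]
theorem coeff_zero : (monicQuadratic u v).coeff 0 = v := by
  simp [monicQuadratic]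

@[simp]
theorem coeff_one : (monicQuadratic u v).coeff 1 = u := by
  simp [monicQuadratic, coeff_X_pow, coeff_C]

@[simp]
theorem nextCoeff_eq : (monicQuadratic u v).nextCoeff = u := by
  rw [nextCoeff_of_natDegree_pos (by simp)]
  simp

theorem nonnegCoeffs_X_add_C_mul {a u v : ℝ} (h₂ : 0 ≤ a + u) (h₁ : 0 ≤ v + a * u)
    (h₀ : 0 ≤ a * v) : NonnegCoeffs ((X + C a) * monicQuadratic u v) := by
  rw [show (X + C a) * monicQuadratic u v =
      X ^ 3 + C (a + u) * X ^ 2 + C (v + a * u) * X + C (a * v) by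
    simp only [monicQuadratic, map_add, map_mul]; ring]
  exact (((NonnegCoeffs.X.pow 3).add ((NonnegCoeffs.C h₂).mul (NonnegCoeffs.X.pow 2))).add
    ((NonnegCoeffs.C h₁).mul NonnegCoeffs.X)).add (NonnegCoeffs.C h₀)

theorem nonnegCoeffs_mul {a b u v : ℝ} (h₃ : 0 ≤ a + u) (h₂ : 0 ≤ b + v + a * u)
    (h₁ : 0 ≤ a * v + b * u) (h₀ : 0 ≤ b * v) :
    NonnegCoeffs (monicQuadratic a b * monicQuadratic u v) := by
  rw [show monicQuadratic a b * monicQuadratic u v =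
      X ^ 4 + C (a + u) * X ^ 3 + C (b + v + a * u) * X ^ 2 + C (a * v + b * u) * X +
        C (b * v) by
    simp only [monicQuadratic, map_add, map_mul]; ring]
  exact ((((NonnegCoeffs.X.pow 4).add ((NonnegCoeffs.C h₃).mul (NonnegCoeffs.X.pow 3))).add
    ((NonnegCoeffs.C h₂).mul (NonnegCoeffs.X.pow 2))).add
    ((NonnegCoeffs.C h₁).mul NonnegCoeffs.X)).add (NonnegCoeffs.C h₀)

end monicQuadratic

theorem Polynomial.Monic.eq_monicQuadratic {p : ℝ[X]} (hp : p.Monic) (h : p.natDegree = 2) :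
    p = monicQuadratic (p.coeff 1) (p.coeff 0) := by
  rw [monicQuadratic.eq_quadratic]
  have h₂ : p.coeff 2 = 1 := h ▸ hp.coeff_natDegree
  have := eq_quadratic_of_degree_le_two (p := p) (natDegree_le_iff_degree_le.1 h.le)
  rwa [h₂] at this

/-- Monic polynomials that are positive on the positive reals. -/
structure PosMonic (p : ℝ[X]) : Prop where
  monic : p.Monic
  eval_pos : ∀ x : ℝ, 0 < x → 0 < p.eval x

namespace PosMonic

variable {p q : ℝ[X]}

protected theorem mul (hp : PosMonic p) (hq : PosMonic q) : PosMonic (p * q) :=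
  ⟨hp.monic.mul hq.monic, fun x hx => by
    rw [eval_mul]; exact mul_pos (hp.eval_pos x hx) (hq.eval_pos x hx)⟩

protected theorem pow (hp : PosMonic p) (n : ℕ) : PosMonic (p ^ n) :=
  ⟨hp.monic.pow n, fun x hx => by rw [eval_pow]; exact pow_pos (hp.eval_pos x hx) n⟩

theorem X_add_C {b : ℝ} (hb : 0 < b) : PosMonic (X + C b) :=
  ⟨monic_X_add_C b, fun x hx => by simp; positivity⟩

theorem monicQuadratic_of_nonneg {u v : ℝ} (hu : 0 ≤ u) (hv : 0 < v) :
    PosMonic (monicQuadratic u v) :=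
  ⟨monicQuadratic.monic u v, fun x hx => by simp [monicQuadratic]; positivity⟩

theorem monicQuadratic_of_sq_lt {u v : ℝ} (h : u ^ 2 < 4 * v) : PosMonic (monicQuadratic u v) :=
  ⟨monicQuadratic.monic u v, fun x _ => by
    simp [monicQuadratic]; nlinarith [sq_nonneg (2 * x + u)]⟩

end PosMonic

/-- The monic counterpart of a multiplicative, degree-preserving, support-preserving map. -/
structure IsSupportPreserving (Φ : ℝ[X] → ℝ[X]) : Prop where
  monic : ∀ {p}, PosMonic p → (Φ p).Monic
  natDegree : ∀ {p}, PosMonic p → (Φ p).natDegree = p.natDegree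
  map_mul : ∀ {p q}, PosMonic p → PosMonic q → Φ (p * q) = Φ p * Φ q
  nonneg : ∀ {p}, PosMonic p → NonnegCoeffs p → NonnegCoeffs (Φ p)
  coeff_eq_zero_iff : ∀ {p}, PosMonic p → NonnegCoeffs p → ∀ k,
    (Φ p).coeff k = 0 ↔ p.coeff k = 0

namespace IsSupportPreserving

variable {Φ : ℝ[X] → ℝ[X]}

theorem nextCoeff_eq_zero (h : IsSupportPreserving Φ) {p : ℝ[X]} (hp : PosMonic p)
    (hp' : NonnegCoeffs p) (h0 : p.nextCoeff = 0) : (Φ p).nextCoeff = 0 := by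
  rcases Nat.eq_zero_or_pos p.natDegree with hd | hd
  · rw [nextCoeff, if_pos (by rw [h.natDegree hp, hd])]
  · rw [nextCoeff_of_natDegree_pos hd] at h0
    rw [nextCoeff_of_natDegree_pos (by rwa [h.natDegree hp]), h.natDegree hp,
      h.coeff_eq_zero_iff hp hp', h0]

theorem nextCoeff_add_eq_zero (h : IsSupportPreserving Φ) {p q : ℝ[X]} (hp : PosMonic p)
    (hq : PosMonic q) (hpq : NonnegCoeffs (p * q)) (h0 : p.nextCoeff + q.nextCoeff = 0) :
    (Φ p).nextCoeff + (Φ q).nextCoeff = 0 := by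
  rw [← (h.monic hp).nextCoeff_mul (h.monic hq), ← h.map_mul hp hq]
  exact h.nextCoeff_eq_zero (hp.mul hq) hpq (by rwa [hp.monic.nextCoeff_mul hq.monic])

theorem coeff_one_mul_eq_zero (h : IsSupportPreserving Φ) {p q : ℝ[X]} (hp : PosMonic p)
    (hq : PosMonic q) (hpq : NonnegCoeffs (p * q))
    (h0 : p.coeff 0 * q.coeff 1 + p.coeff 1 * q.coeff 0 = 0) :
    (Φ p).coeff 0 * (Φ q).coeff 1 + (Φ p).coeff 1 * (Φ q).coeff 0 = 0 := by
  rw [← mul_coeff_one, ← h.map_mul hp hq, h.coeff_eq_zero_iff (hp.mul hq) hpq, mul_coeff_one, h0]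

theorem nextCoeff_map_monicQuadratic (h : IsSupportPreserving Φ) {u v : ℝ}
    (hp : PosMonic (monicQuadratic u v)) :
    (Φ (monicQuadratic u v)).nextCoeff = (Φ (monicQuadratic u v)).coeff 1 := by
  have hd := h.natDegree hp
  rw [monicQuadratic.natDegree_eq] at hd
  rw [nextCoeff_of_natDegree_pos (by omega), hd]

theorem map_monicQuadratic (h : IsSupportPreserving Φ) {u v : ℝ}
    (hp : PosMonic (monicQuadratic u v)) (h₁ : (Φ (monicQuadratic u v)).nextCoeff = u)
    (h₀ : (Φ (monicQuadratic u v)).coeff 0 = v) :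
    Φ (monicQuadratic u v) = monicQuadratic u v := by
  rw [h.nextCoeff_map_monicQuadratic hp] at h₁
  conv_lhs => rw [(h.monic hp).eq_monicQuadratic (by rw [h.natDegree hp]; simp), h₁, h₀]

theorem map_X_add_C (h : IsSupportPreserving Φ) (h1 : Φ (X + C 1) = X + C 1) {b : ℝ}
    (hb : 0 < b) : Φ (X + C b) = X + C b := by
  have hX : ∀ c : ℝ, 0 < c → Φ (X + C c) = X + C ((Φ (X + C c)).coeff 0) := fun c hc =>
    (h.monic (PosMonic.X_add_C hc)).eq_X_add_C
      (by rw [h.natDegree (PosMonic.X_add_C hc), natDegree_X_add_C])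
  have hnext : ∀ c : ℝ, 0 < c → (Φ (X + C c)).nextCoeff = (Φ (X + C c)).coeff 0 := fun c hc => by
    rw [hX c hc]; simp
  rw [hX b hb, eq_self_of_additive_nonneg (f := fun c => (Φ (X + C c)).coeff 0) _ _ _ hb]
  · intro c hc
    exact h.nonneg (PosMonic.X_add_C hc) (NonnegCoeffs.X.add (NonnegCoeffs.C hc.le)) 0
  · intro c d hc hd
    have hcd : 0 < c + d := add_pos hc hd
    have hq : PosMonic (monicQuadratic (-(c + d)) ((c + d) ^ 2)) :=
      PosMonic.monicQuadratic_of_sq_lt (by nlinarith)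
    have e : monicQuadratic (c + d) (c * d) = (X + C c) * (X + C d) := by
      simp only [monicQuadratic, C_add, C_mul]; ring
    have hP := (PosMonic.X_add_C hc).mul (PosMonic.X_add_C hd)
    have s₁ := h.nextCoeff_add_eq_zero (PosMonic.X_add_C hcd) hq
      (monicQuadratic.nonnegCoeffs_X_add_C_mul (by linarith) (by linarith) (by positivity))
      (by rw [nextCoeff_X_add_C, monicQuadratic.nextCoeff_eq, add_neg_cancel])
    have s₂ := h.nextCoeff_add_eq_zero (e ▸ hP) hq
      (monicQuadratic.nonnegCoeffs_mul (by linarith) (by nlinarith [mul_pos hc hd])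
        (by nlinarith [mul_pos hc hd, mul_pos hcd (mul_pos hc hd), mul_pos hcd (pow_pos hc 2),
          mul_pos hcd (pow_pos hd 2)]) (by positivity))
      (by simp)
    rw [e, h.map_mul (PosMonic.X_add_C hc) (PosMonic.X_add_C hd),
      (h.monic (PosMonic.X_add_C hc)).nextCoeff_mul (h.monic (PosMonic.X_add_C hd)),
      hnext c hc, hnext d hd] at s₂
    rw [hnext _ hcd] at s₁
    linarith
  · simp only [h1]; simp

theorem map_monicQuadratic_neg_of_sq_le (h : IsSupportPreserving Φ) (h1 : Φ (X + C 1) = X + C 1)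
    {u v : ℝ} (hu : 0 < u) (huv : u ^ 2 ≤ v) :
    Φ (monicQuadratic (-u) v) = monicQuadratic (-u) v := by
  have hv : 0 < v := lt_of_lt_of_le (by positivity) huv
  have hq : PosMonic (monicQuadratic (-u) v) := PosMonic.monicQuadratic_of_sq_lt (by nlinarith)
  have hw : 0 < v / u := by positivity
  have hwu : u ≤ v / u := by rw [le_div_iff₀ hu]; nlinarith
  have hvu : v / u * u = v := div_mul_cancel₀ v hu.ne'
  have s₁ := h.nextCoeff_add_eq_zero (PosMonic.X_add_C hu) hq
    (monicQuadratic.nonnegCoeffs_X_add_C_mul (by linarith) (by nlinarith) (by positivity))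
    (by simp)
  have s₂ := h.coeff_one_mul_eq_zero (PosMonic.X_add_C hw) hq
    (monicQuadratic.nonnegCoeffs_X_add_C_mul (by linarith) (by linarith) (by positivity))
    (by simp; linarith)
  rw [h.map_X_add_C h1 hu, nextCoeff_X_add_C] at s₁
  have s₃ : (Φ (monicQuadratic (-u) v)).nextCoeff = -u := by linarith
  refine h.map_monicQuadratic hq s₃ ?_
  rw [h.nextCoeff_map_monicQuadratic hq] at s₃
  rw [h.map_X_add_C h1 hw, s₃] at s₂
  simp at s₂
  linarith

theorem map_monicQuadratic_of_pos (h : IsSupportPreserving Φ) (h1 : Φ (X + C 1) = X + C 1)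
    {u v : ℝ} (hu : 0 < u) (hv : 0 < v) : Φ (monicQuadratic u v) = monicQuadratic u v := by
  have hq : PosMonic (monicQuadratic u v) := PosMonic.monicQuadratic_of_nonneg hu.le hv
  have s₁ := h.nextCoeff_add_eq_zero hq
    (PosMonic.monicQuadratic_of_sq_lt (u := -u) (v := u ^ 2 + v) (by nlinarith))
    (monicQuadratic.nonnegCoeffs_mul (by linarith) (by nlinarith) (by nlinarith [pow_pos hu 3])
      (by positivity)) (by simp)
  rw [h.map_monicQuadratic_neg_of_sq_le h1 hu (by linarith), monicQuadratic.nextCoeff_eq] at s₁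
  have s₃ : (Φ (monicQuadratic u v)).nextCoeff = u := by linarith
  refine h.map_monicQuadratic hq s₃ ?_
  -- The partner `X² - wX + z` is chosen so that the linear coefficient of the product vanishes.
  obtain ⟨z, hz⟩ : ∃ z, z = v ^ 2 / (u ^ 2 + v) := ⟨_, rfl⟩
  obtain ⟨w, hw⟩ : ∃ w, w = u * v / (u ^ 2 + v) := ⟨_, rfl⟩
  have hD : 0 < u ^ 2 + v := by positivity
  have hz0 : 0 < z := by rw [hz]; positivity
  have hw0 : 0 < w := by rw [hw]; positivity
  have hwu : w ≤ u := by rw [hw, div_le_iff₀ hD]; nlinarith [pow_pos hu 3]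
  have huw : u * w ≤ v := by
    rw [hw, ← mul_div_assoc, div_le_iff₀ hD]; nlinarith [pow_pos hv 2]
  have hwz : w ^ 2 ≤ z := by
    rw [hw, hz, div_pow, div_le_div_iff₀ (by positivity) hD]
    nlinarith [mul_pos (pow_pos hv 3) hD]
  have hrel : u * z = v * w := by rw [hw, hz]; field_simp
  have s₂ := h.coeff_one_mul_eq_zero hq
    (PosMonic.monicQuadratic_of_sq_lt (u := -w) (v := z) (by nlinarith))
    (monicQuadratic.nonnegCoeffs_mul (by linarith) (by nlinarith) (by nlinarith)
      (by positivity)) (by simp; linarith)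
  rw [h.map_monicQuadratic_neg_of_sq_le h1 hw0 hwz,
    ← h.nextCoeff_map_monicQuadratic hq, s₃] at s₂
  simp only [monicQuadratic.coeff_one, monicQuadratic.coeff_zero] at s₂
  exact mul_right_cancel₀ hw0.ne' (by linarith)

end IsSupportPreserving

/-- Multiplying by `X² + uX + v` turns `X² - uX + v` into an even polynomial. -/
theorem exists_nonnegCoeffs_monicQuadratic_mul_pow {u v : ℝ} (huv : u ^ 2 < 4 * v) :
    ∃ N : ℕ, NonnegCoeffs (monicQuadratic (-u) v *
      (monicQuadratic u v * monicQuadratic 0 v ^ N)) := by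
  have hv : 0 < v := by nlinarith
  obtain ⟨N, hN⟩ := exists_nonnegCoeffs_mul_X_add_one_pow (b := (u ^ 2 - 2 * v) / v)
    (by rw [le_div_iff₀ hv]; nlinarith) (by rw [div_lt_iff₀ hv]; nlinarith)
  refine ⟨N, ?_⟩
  have key := (NonnegCoeffs.C (pow_pos hv (N + 2)).le).mul
    (hN.comp ((NonnegCoeffs.C (inv_pos.2 hv).le).mul (NonnegCoeffs.X.pow 2)))
  convert key using 1
  have hC : (C v * C v⁻¹ : ℝ[X]) = 1 := by rw [← C_mul, mul_inv_cancel₀ hv.ne', C_1]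
  have hb : (C v * C ((u ^ 2 - 2 * v) / v) : ℝ[X]) = C u ^ 2 - 2 * C v := by
    rw [← C_mul, mul_div_cancel₀ _ hv.ne', C_sub, C_pow, C_mul, C_ofNat]
  have e₁ : monicQuadratic 0 v = C v * (C v⁻¹ * X ^ 2 + 1) := by
    simp only [monicQuadratic, C_0]; linear_combination (-X ^ 2) * hC
  have e₂ : monicQuadratic (-u) v * monicQuadratic u v = C v ^ 2 *
      ((C v⁻¹ * X ^ 2) ^ 2 - C ((u ^ 2 - 2 * v) / v) * (C v⁻¹ * X ^ 2) + 1) := by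
    simp only [monicQuadratic, C_neg]
    linear_combination (-X ^ 4 * (C v * C v⁻¹ + 1) + X ^ 2 * (C u ^ 2 - 2 * C v)) * hC
      + X ^ 2 * C v * C v⁻¹ * hb
  rw [← mul_assoc, e₂, e₁, mul_pow]
  simp only [mul_comp, add_comp, sub_comp, pow_comp, X_comp, C_comp, C_1, C_pow, one_comp, mul_pow (C v)]
  ring

namespace IsSupportPreserving

variable {Φ : ℝ[X] → ℝ[X]}

theorem map_monicQuadratic_neg (h : IsSupportPreserving Φ) (h1 : Φ (X + C 1) = X + C 1)
    {u v : ℝ} (hu : 0 < u) (huv : u ^ 2 < 4 * v) :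
    Φ (monicQuadratic (-u) v) = monicQuadratic (-u) v := by
  have hv : 0 < v := by nlinarith
  obtain ⟨N, hN⟩ := exists_nonnegCoeffs_monicQuadratic_mul_pow huv
  have hq : PosMonic (monicQuadratic (-u) v) := PosMonic.monicQuadratic_of_sq_lt (by linarith)
  have hr : PosMonic (monicQuadratic u v) := PosMonic.monicQuadratic_of_nonneg hu.le hv
  have hH : PosMonic (monicQuadratic 0 v ^ N) :=
    (PosMonic.monicQuadratic_of_nonneg le_rfl hv).pow N
  have hH' : NonnegCoeffs (monicQuadratic 0 v ^ N) :=
    (((NonnegCoeffs.X.pow 2).add ((NonnegCoeffs.C le_rfl).mul NonnegCoeffs.X)).add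
      (NonnegCoeffs.C hv.le)).pow N
  have hnext : (monicQuadratic 0 v ^ N).nextCoeff = 0 := by
    rw [(monicQuadratic.monic 0 v).nextCoeff_pow]; simp
  have hone : (monicQuadratic 0 v ^ N).coeff 1 = 0 := by
    rw [show monicQuadratic 0 v ^ N = expand ℝ 2 ((X + C v) ^ N) by simp [monicQuadratic],
      coeff_expand two_pos]
    simp
  have hzero : (monicQuadratic 0 v ^ N).coeff 0 ≠ 0 := by
    rw [coeff_zero_eq_eval_zero, eval_pow, ← coeff_zero_eq_eval_zero]
    simp [hv.ne']
  have hone' := (h.coeff_eq_zero_iff hH hH' 1).2 hone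
  have hzero' := mt (h.coeff_eq_zero_iff hH hH' 0).1 hzero
  have s₁ := h.nextCoeff_add_eq_zero hq (hr.mul hH) hN
    (by rw [hr.monic.nextCoeff_mul hH.monic, hnext]; simp)
  have s₂ := h.coeff_one_mul_eq_zero hq (hr.mul hH) hN
    (by rw [mul_coeff_one, mul_coeff_zero, hone]; simp; ring)
  rw [h.map_mul hr hH] at s₁ s₂
  rw [(h.monic hr).nextCoeff_mul (h.monic hH), h.nextCoeff_eq_zero hH hH' hnext,
    h.map_monicQuadratic_of_pos h1 hu hv, monicQuadratic.nextCoeff_eq] at s₁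
  have s₃ : (Φ (monicQuadratic (-u) v)).nextCoeff = -u := by linarith
  refine h.map_monicQuadratic hq s₃ ?_
  rw [mul_coeff_one, mul_coeff_zero, hone', ← h.nextCoeff_map_monicQuadratic hq, s₃,
    h.map_monicQuadratic_of_pos h1 hu hv] at s₂
  simp only [monicQuadratic.coeff_one, monicQuadratic.coeff_zero] at s₂
  exact mul_right_cancel₀ (mul_ne_zero hu.ne' hzero') (by linear_combination s₂)

theorem map_monicQuadratic_zero (h : IsSupportPreserving Φ) (h1 : Φ (X + C 1) = X + C 1)
    {v : ℝ} (hv : 0 < v) : Φ (monicQuadratic 0 v) = monicQuadratic 0 v := by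
  have hq : PosMonic (monicQuadratic 0 v) := PosMonic.monicQuadratic_of_nonneg le_rfl hv
  have hq' : NonnegCoeffs (monicQuadratic 0 v) :=
    ((NonnegCoeffs.X.pow 2).add ((NonnegCoeffs.C le_rfl).mul NonnegCoeffs.X)).add
      (NonnegCoeffs.C hv.le)
  have hone : (Φ (monicQuadratic 0 v)).coeff 1 = 0 := (h.coeff_eq_zero_iff hq hq' 1).2 (by simp)
  set s := √(3 * v)
  have hs : s ^ 2 = 3 * v := Real.sq_sqrt (by positivity)
  have hs0 : 0 < s := Real.sqrt_pos.2 (by positivity)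
  have hr : PosMonic (monicQuadratic s v) := PosMonic.monicQuadratic_of_nonneg hs0.le hv
  have hr' : PosMonic (monicQuadratic (-s) v) :=
    PosMonic.monicQuadratic_of_sq_lt (by linarith)
  have hprod : ∀ t, monicQuadratic 0 t * (monicQuadratic s v * monicQuadratic (-s) v) =
      X ^ 6 + C (t - v) * X ^ 4 + C (v ^ 2 - t * v) * X ^ 2 + C (t * v ^ 2) := fun t => by
    have hsC : (C s ^ 2 : ℝ[X]) = 3 * C v := by rw [← C_pow, hs, C_mul, C_ofNat]
    simp only [monicQuadratic, C_neg, C_0, C_mul, C_sub, C_pow]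
    linear_combination (-X ^ 2 * (X ^ 2 + C t)) * hsC
  have hnn : NonnegCoeffs (monicQuadratic 0 v * (monicQuadratic s v * monicQuadratic (-s) v)) := by
    rw [hprod, sub_self, show v ^ 2 - v * v = 0 by ring]
    exact (((NonnegCoeffs.X.pow 6).add ((NonnegCoeffs.C le_rfl).mul (NonnegCoeffs.X.pow 4))).add
      ((NonnegCoeffs.C le_rfl).mul (NonnegCoeffs.X.pow 2))).add (NonnegCoeffs.C (by positivity))
  have hcoeff : ∀ t, (monicQuadratic 0 t * (monicQuadratic s v * monicQuadratic (-s) v)).coeff 4 =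
      t - v := fun t => by
    rw [hprod]
    simp only [coeff_add, coeff_C_mul, coeff_X_pow, coeff_C]
    norm_num
  have hquad : Φ (monicQuadratic 0 v) = monicQuadratic 0 ((Φ (monicQuadratic 0 v)).coeff 0) := by
    conv_lhs =>
      rw [(h.monic hq).eq_monicQuadratic (by rw [h.natDegree hq]; simp), hone]
  have h4 := (h.coeff_eq_zero_iff (hq.mul (hr.mul hr')) hnn 4).2
    (by rw [hcoeff, sub_self])
  rw [h.map_mul hq (hr.mul hr'), h.map_mul hr hr', h.map_monicQuadratic_of_pos h1 hs0 hv,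
    h.map_monicQuadratic_neg h1 hs0 (by linarith), hquad, hcoeff] at h4
  refine h.map_monicQuadratic hq (by rw [h.nextCoeff_map_monicQuadratic hq, hone]) ?_
  linarith

theorem map_monicQuadratic_of_sq_lt (h : IsSupportPreserving Φ) (h1 : Φ (X + C 1) = X + C 1)
    {u v : ℝ} (huv : u ^ 2 < 4 * v) : Φ (monicQuadratic u v) = monicQuadratic u v := by
  have hv : 0 < v := by nlinarith [sq_nonneg u]
  rcases lt_trichotomy u 0 with hu | rfl | hu
  · simpa using h.map_monicQuadratic_neg h1 (neg_pos.2 hu) (by simpa using huv)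
  · exact h.map_monicQuadratic_zero h1 hv
  · exact h.map_monicQuadratic_of_pos h1 hu hv

end IsSupportPreserving

/-- The representative in `Mset` of the positive multiples of `p`. -/
noncomputable def evalOneNormalize (p : ℝ[X]) : ℝ[X] := C (p.eval 1)⁻¹ * p

theorem evalOneNormalize_mul (p q : ℝ[X]) :
    evalOneNormalize (p * q) = evalOneNormalize p * evalOneNormalize q := by
  simp only [evalOneNormalize, eval_mul, mul_inv, C_mul]; ring

theorem PosMonic.evalOneNormalize_mem {p : ℝ[X]} (hp : PosMonic p) :
    evalOneNormalize p ∈ Mset := by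
  have h1 := hp.eval_pos 1 one_pos
  refine ⟨by simp [evalOneNormalize, h1.ne'], fun x hx => ?_⟩
  rw [evalOneNormalize, eval_mul, eval_C]
  exact mul_pos (inv_pos.2 h1) (hp.eval_pos x hx)

theorem PosMonic.evalOneNormalize_mem_Pset {p : ℝ[X]} (hp : PosMonic p) (hp' : NonnegCoeffs p) :
    evalOneNormalize p ∈ Pset :=
  ⟨((NonnegCoeffs.C (inv_pos.2 (hp.eval_pos 1 one_pos)).le).mul hp'),
    hp.evalOneNormalize_mem.1⟩

theorem Mset_ne_zero {p : ℝ[X]} (hp : p ∈ Mset) : p ≠ 0 := by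
  rintro rfl
  simpa using hp.1

/-- The map on monic polynomials induced by a map on `Mset`. -/
noncomputable def monicMap (Ψ : ℝ[X] → ℝ[X]) (p : ℝ[X]) : ℝ[X] :=
  C (Ψ (evalOneNormalize p)).leadingCoeff⁻¹ * Ψ (evalOneNormalize p)

theorem map_evalOneNormalize_of_monicMap_eq {Ψ : ℝ[X] → ℝ[X]} (hmapM : ∀ q ∈ Mset, Ψ q ∈ Mset)
    {p q : ℝ[X]} (hp : PosMonic p) (h : monicMap Ψ p = q) :
    Ψ (evalOneNormalize p) = evalOneNormalize q := by
  have hM := hmapM _ hp.evalOneNormalize_mem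
  have hl := leadingCoeff_ne_zero.2 (Mset_ne_zero hM)
  subst h
  change _ = C ((monicMap Ψ p).eval 1)⁻¹ * monicMap Ψ p
  rw [monicMap, eval_mul, eval_C, hM.1, mul_one, inv_inv, ← mul_assoc,
    ← C_mul, mul_inv_cancel₀ hl, C_1, one_mul]

theorem isSupportPreserving_monicMap {Ψ : ℝ[X] → ℝ[X]}
    (hmapM : ∀ q ∈ Mset, Ψ q ∈ Mset)
    (hmul : ∀ p ∈ Mset, ∀ q ∈ Mset, Ψ (p * q) = Ψ p * Ψ q)
    (hdeg : ∀ q ∈ Mset, (Ψ q).degree = q.degree)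
    (hmapP : ∀ p ∈ Pset, Ψ p ∈ Pset)
    (hsupp : ∀ p ∈ Pset, ∀ k : ℕ, 0 < (Ψ p).coeff k ↔ 0 < p.coeff k) :
    IsSupportPreserving (monicMap Ψ) where
  monic {p} hp := by
    have hl := leadingCoeff_ne_zero.2 (Mset_ne_zero (hmapM _ hp.evalOneNormalize_mem))
    rw [Monic, monicMap, leadingCoeff_mul, leadingCoeff_C, inv_mul_cancel₀ hl]
  natDegree {p} hp := by
    have hl := leadingCoeff_ne_zero.2 (Mset_ne_zero (hmapM _ hp.evalOneNormalize_mem))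
    rw [monicMap, natDegree_C_mul (inv_ne_zero hl),
      natDegree_eq_of_degree_eq (hdeg _ hp.evalOneNormalize_mem), evalOneNormalize,
      natDegree_C_mul (inv_ne_zero (hp.eval_pos 1 one_pos).ne')]
  map_mul {p q} hp hq := by
    simp only [monicMap]
    rw [evalOneNormalize_mul, hmul _ hp.evalOneNormalize_mem _ hq.evalOneNormalize_mem,
      leadingCoeff_mul, mul_inv, C_mul]
    ring
  nonneg {p} hp hp' := by
    have hP := hmapP _ (hp.evalOneNormalize_mem_Pset hp')
    exact (NonnegCoeffs.C (inv_nonneg.2 (hP.1 _))).mul hP.1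
  coeff_eq_zero_iff {p} hp hp' k := by
    have hl := leadingCoeff_ne_zero.2 (Mset_ne_zero (hmapM _ hp.evalOneNormalize_mem))
    have hP := hp.evalOneNormalize_mem_Pset hp'
    have hs := not_congr (hsupp _ hP k)
    rw [((hmapP _ hP).1 k).not_lt_iff_eq, (hP.1 k).not_lt_iff_eq, evalOneNormalize,
      coeff_C_mul] at hs
    rw [monicMap, coeff_C_mul, mul_eq_zero, or_iff_right (inv_ne_zero hl), evalOneNormalize,
      eq_comm, hs, eq_comm, mul_eq_zero, or_iff_right (inv_ne_zero (hp.eval_pos 1 one_pos).ne')]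

theorem stmt_15 (Ψ : Polynomial ℝ → Polynomial ℝ)
    (hmapM : ∀ q ∈ Mset, Ψ q ∈ Mset)
    (hmul : ∀ p ∈ Mset, ∀ q ∈ Mset, Ψ (p * q) = Ψ p * Ψ q)
    (hdeg : ∀ q ∈ Mset, (Ψ q).degree = q.degree)
    (hmapP : ∀ p ∈ Pset, Ψ p ∈ Pset)
    (hsupp : ∀ p ∈ Pset, ∀ k : ℕ, 0 < (Ψ p).coeff k ↔ 0 < p.coeff k)
    (hfix : Ψ (lin 1) = lin 1) :
    ∀ a : ℝ, a ∈ Set.Ioo (-2 : ℝ) 2 → ∀ γ : ℝ, 0 < γ →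
      Ψ (C (1 - a * γ + γ ^ 2)⁻¹ * (X ^ 2 - C (a * γ) * X + C (γ ^ 2))) =
        C (1 - a * γ + γ ^ 2)⁻¹ * (X ^ 2 - C (a * γ) * X + C (γ ^ 2)) := by
  intro a ha γ hγ
  have h := isSupportPreserving_monicMap hmapM hmul hdeg hmapP hsupp
  have e₁ : evalOneNormalize (X + C 1) = lin 1 := by simp [evalOneNormalize, lin]
  have h1 : monicMap Ψ (X + C 1) = X + C 1 := by
    have hl : (lin 1).leadingCoeff = (1 + 1)⁻¹ := by
      rw [lin, leadingCoeff_mul, leadingCoeff_C, leadingCoeff_X_add_C, mul_one]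
    rw [monicMap, e₁, hfix, hl, lin, ← mul_assoc, ← C_mul]
    norm_num
  have hlt : (-(a * γ)) ^ 2 < 4 * γ ^ 2 := by
    nlinarith [mul_pos (mul_pos (sub_pos.2 ha.2) (by linarith [ha.1] : 0 < a + 2)) (pow_pos hγ 2)]
  have e₂ : evalOneNormalize (monicQuadratic (-(a * γ)) (γ ^ 2)) =
      C (1 - a * γ + γ ^ 2)⁻¹ * (X ^ 2 - C (a * γ) * X + C (γ ^ 2)) := by
    have he : (monicQuadratic (-(a * γ)) (γ ^ 2)).eval 1 = 1 - a * γ + γ ^ 2 := by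
      simp [monicQuadratic, ← sub_eq_add_neg]
    rw [evalOneNormalize, he, monicQuadratic, C_neg, neg_mul, ← sub_eq_add_neg]
  rw [← e₂]
  exact map_evalOneNormalize_of_monicMap_eq hmapM (PosMonic.monicQuadratic_of_sq_lt hlt)
    (h.map_monicQuadratic_of_sq_lt h1 hlt)
end

section
/- Let p, p' ∈ 𝒫 with deg p' ≤ deg p and with the constant coefficient of p nonzero. Then p = p' if and only if S_p ⊆ S_{p'}, where S_r = {q ∈ ℳ : q·r ∈ 𝒫}. -/
open Polynomial

/-- `Sset r` is the set of `q ∈ Mset` such that all coefficients of `q * r` are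
nonnegative. -/
def Sset (r : Polynomial ℝ) : Set (Polynomial ℝ) :=
  {q | q ∈ Mset ∧ ∀ k : ℕ, 0 ≤ (q * r).coeff k}

/-- The sum of the monomials `X ^ i` with `i ∈ s`. -/
noncomputable def indicatorPoly (s : Finset ℕ) : ℝ[X] := ∑ i ∈ s, X ^ i

lemma coeff_indicatorPoly (s : Finset ℕ) (k : ℕ) :
    (indicatorPoly s).coeff k = if k ∈ s then 1 else 0 := by
  simp [indicatorPoly, coeff_X_pow]

lemma coeff_indicatorPoly_mul (s : Finset ℕ) (r : ℝ[X]) (j : ℕ) :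
    (indicatorPoly s * r).coeff j = ∑ i ∈ s, if i ≤ j then r.coeff (j - i) else 0 := by
  simp [indicatorPoly, Finset.sum_mul, coeff_X_pow_mul']

lemma coeff_indicatorPoly_mul_nonneg (s : Finset ℕ) {r : ℝ[X]} (hr : ∀ k, 0 ≤ r.coeff k)
    (j : ℕ) : 0 ≤ (indicatorPoly s * r).coeff j := by
  rw [coeff_indicatorPoly_mul]
  refine Finset.sum_nonneg fun i _ => ?_
  split_ifs
  exacts [hr _, le_rfl]

lemma sum_coeff_le_eval_one {r : ℝ[X]} (hr : ∀ k, 0 ≤ r.coeff k) (n : ℕ) :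
    ∑ k ∈ Finset.range n, r.coeff k ≤ r.eval 1 := by
  rw [eval_eq_sum_range' (n := max n (r.natDegree + 1)) (by omega)]
  simp only [one_pow, mul_one]
  exact Finset.sum_le_sum_of_subset_of_nonneg (Finset.range_mono (le_max_left _ _))
    fun k _ _ => hr k

lemma coeff_indicatorPoly_mul_le (s : Finset ℕ) {r : ℝ[X]} (hr : ∀ k, 0 ≤ r.coeff k)
    (j : ℕ) : (indicatorPoly s * r).coeff j ≤ r.eval 1 := by
  rw [mul_comm, coeff_mul, Finset.Nat.sum_antidiagonal_eq_sum_range_succ_mk]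
  refine le_trans (Finset.sum_le_sum fun k _ => ?_) (sum_coeff_le_eval_one hr (j + 1))
  rw [coeff_indicatorPoly]
  split_ifs
  · simp
  · simpa using hr k

lemma coeff_le_coeff_indicatorPoly_mul {s : Finset ℕ} {r : ℝ[X]} (hr : ∀ k, 0 ≤ r.coeff k)
    {i : ℕ} (hi : i ∈ s) (m : ℕ) : r.coeff m ≤ (indicatorPoly s * r).coeff (i + m) := by
  rw [coeff_indicatorPoly_mul]
  refine le_trans (by simp) (Finset.single_le_sum (fun k _ => ?_) hi)
  split_ifs
  exacts [hr _, le_rfl]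

lemma coeff_indicatorPoly_mul_eq_zero {s : Finset ℕ} {r : ℝ[X]} {j : ℕ}
    (h : ∀ i ∈ s, i ≤ j → r.natDegree < j - i) : (indicatorPoly s * r).coeff j = 0 := by
  rw [coeff_indicatorPoly_mul]
  refine Finset.sum_eq_zero fun i hi => ?_
  split_ifs with hij
  exacts [coeff_eq_zero_of_natDegree_lt (h i hi hij), rfl]

lemma coeff_indicatorPoly_Icc_mul {r : ℝ[X]} {n : ℕ} (hr : r.natDegree ≤ n) :
    (indicatorPoly (Finset.Icc n (2 * n)) * r).coeff (2 * n) = r.eval 1 := by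
  rw [coeff_indicatorPoly_mul, eval_eq_sum_range' (n := n + 1) (by omega)]
  refine Finset.sum_nbij' (fun i => 2 * n - i) (fun i => 2 * n - i) ?_ ?_ ?_ ?_ ?_
  · intro i hi; simp only [Finset.mem_Icc, Finset.mem_range] at *; omega
  · intro i hi; simp only [Finset.mem_Icc, Finset.mem_range] at *; omega
  · intro i hi; simp only [Finset.mem_Icc] at *; omega
  · intro i hi; simp only [Finset.mem_range] at *; omega
  · intro i hi
    simp [(Finset.mem_Icc.1 hi).2]

/-- Two polynomials of mass one, one of which dominates the other coefficientwise, agree. -/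
lemma eq_of_coeff_le_of_eval_one_eq {p r : ℝ[X]} (h : ∀ k, p.coeff k ≤ r.coeff k)
    (h1 : p.eval 1 = r.eval 1) : p = r := by
  ext k
  have hnn : ∀ k, 0 ≤ (r - p).coeff k := fun k => by simpa using h k
  have hk := (Finset.single_le_sum (fun i _ => hnn i) (Finset.self_mem_range_succ k)).trans
    (sum_coeff_le_eval_one hnn (k + 1))
  rw [eval_sub, coeff_sub, h1] at hk
  linarith [h k]

lemma eval_pos_of_coeff_nonneg {r : ℝ[X]} (hr : ∀ k, 0 ≤ r.coeff k) (h : r ≠ 0) {x : ℝ}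
    (hx : 0 < x) : 0 < r.eval x := by
  rw [eval_eq_sum]
  refine Finset.sum_pos (fun k hk => ?_) (by simpa using h)
  exact mul_pos (lt_of_le_of_ne (hr k) (Ne.symm (mem_support_iff.1 hk))) (pow_pos hx k)

/-- The inclusion `Sset p ⊆ Sset p'` transfers coefficientwise nonnegativity without any
normalization of the multiplier. -/
lemma coeff_mul_nonneg_of_Sset_subset {p p' q : ℝ[X]} (hp : p ∈ Pset)
    (hS : Sset p ⊆ Sset p') (hq : ∀ k, 0 ≤ (q * p).coeff k) (k : ℕ) :
    0 ≤ (q * p').coeff k := by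
  have hp0 : p ≠ 0 := by
    rintro rfl
    simpa using hp.2
  rcases eq_or_ne q 0 with rfl | hq0
  · simp
  have hpos : ∀ x : ℝ, 0 < x → 0 < q.eval x := fun x hx => by
    have h := eval_pos_of_coeff_nonneg hq (mul_ne_zero hq0 hp0) hx
    rw [eval_mul] at h
    exact pos_of_mul_pos_left h (eval_pos_of_coeff_nonneg hp.1 hp0 hx).le
  have h1 := hpos 1 one_pos
  have hmem : C (q.eval 1)⁻¹ * q ∈ Sset p := by
    refine ⟨⟨by simp [h1.ne'], fun x hx => ?_⟩, fun k => ?_⟩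
    · rw [eval_mul, eval_C]
      exact mul_pos (inv_pos.2 h1) (hpos x hx)
    · rw [mul_assoc, coeff_C_mul]
      exact mul_nonneg (inv_pos.2 h1).le (hq k)
  have h := (hS hmem).2 k
  rw [mul_assoc, coeff_C_mul] at h
  exact nonneg_of_mul_nonneg_right h (inv_pos.2 h1)

/-- With `n` the degree of `p`, the multiplier
`X ^ (2n - d) - p_d (X ^ n + ⋯ + X ^ (2n)) + M (1 + ⋯ + X ^ (n-1) + X ^ (2n+1) + ⋯ + X ^ (3n))`
tests the inequality `p_d ≤ p'_d` in its coefficient of index `2n`. -/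
lemma coeff_le_coeff_of_Sset_subset {p p' : ℝ[X]} (hp : p ∈ Pset) (hp' : p' ∈ Pset)
    (hdeg : p'.natDegree ≤ p.natDegree) (h0 : p.coeff 0 ≠ 0) (hS : Sset p ⊆ Sset p') (d : ℕ) :
    p.coeff d ≤ p'.coeff d := by
  obtain ⟨hnn, hp1⟩ := hp
  set n := p.natDegree with hn
  rcases lt_or_ge n d with hd | hd
  · rw [coeff_eq_zero_of_natDegree_lt hd]
    exact hp'.1 d
  have hc0 : 0 < p.coeff 0 := lt_of_le_of_ne (hnn 0) h0.symm
  have hcn : 0 < p.coeff n := by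
    refine lt_of_le_of_ne (hnn n) (Ne.symm ?_)
    rw [hn, coeff_natDegree, leadingCoeff_ne_zero]
    rintro rfl
    simp at h0
  set M : ℝ := p.coeff d / p.coeff 0 + p.coeff d / p.coeff n with hM
  set I := indicatorPoly (Finset.Icc n (2 * n)) with hI
  set G := indicatorPoly (Finset.range n ∪ Finset.Ioc (2 * n) (3 * n)) with hG
  have hM0 : 0 ≤ M := add_nonneg (div_nonneg (hnn d) hc0.le) (div_nonneg (hnn d) hcn.le)
  have hMc0 : p.coeff d ≤ M * p.coeff 0 := by
    rw [← div_le_iff₀ hc0, hM]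
    exact le_add_of_nonneg_right (div_nonneg (hnn d) hcn.le)
  have hMcn : p.coeff d ≤ M * p.coeff n := by
    rw [← div_le_iff₀ hcn, hM]
    exact le_add_of_nonneg_left (div_nonneg (hnn d) hc0.le)
  have hcoeff : ∀ (r : ℝ[X]) (j : ℕ),
      ((X ^ (2 * n - d) - C (p.coeff d) * I + C M * G) * r).coeff j =
        (if 2 * n - d ≤ j then r.coeff (j - (2 * n - d)) else 0)
          - p.coeff d * (I * r).coeff j + M * (G * r).coeff j := fun r j => by
    simp only [add_mul, sub_mul, mul_assoc, coeff_add, coeff_sub, coeff_C_mul, coeff_X_pow_mul']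
  have hGmid : ∀ r : ℝ[X], r.natDegree ≤ n → (G * r).coeff (2 * n) = 0 := fun r hr =>
    coeff_indicatorPoly_mul_eq_zero fun i hi hij => by
      simp only [Finset.mem_union, Finset.mem_range, Finset.mem_Ioc] at hi
      omega
  have hmid : ∀ r : ℝ[X], r.natDegree ≤ n →
      ((X ^ (2 * n - d) - C (p.coeff d) * I + C M * G) * r).coeff (2 * n) =
        r.coeff d - p.coeff d * r.eval 1 := fun r hr => by
    rw [hcoeff, hGmid r hr, coeff_indicatorPoly_Icc_mul hr, if_pos (by omega),
      show 2 * n - (2 * n - d) = d by omega]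
    ring
  have key : ∀ j, 0 ≤ ((X ^ (2 * n - d) - C (p.coeff d) * I + C M * G) * p).coeff j := by
    intro j
    rcases eq_or_ne j (2 * n) with rfl | hj
    · rw [hmid p le_rfl, hp1]
      simp
    have hX : 0 ≤ if 2 * n - d ≤ j then p.coeff (j - (2 * n - d)) else 0 := by
      split_ifs
      exacts [hnn _, le_rfl]
    suffices p.coeff d * (I * p).coeff j ≤ M * (G * p).coeff j by
      rw [hcoeff]
      linarith
    have hI1 : p.coeff d * (I * p).coeff j ≤ p.coeff d :=
      mul_le_of_le_one_right (hnn d) (hp1 ▸ coeff_indicatorPoly_mul_le _ hnn j)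
    by_cases hout : j < n ∨ 3 * n < j
    · rw [hI, coeff_indicatorPoly_mul_eq_zero, mul_zero]
      · exact mul_nonneg hM0 (coeff_indicatorPoly_mul_nonneg _ hnn j)
      · intro i hi hij
        rw [Finset.mem_Icc] at hi
        omega
    rcases lt_or_gt_of_ne hj with hlt | hgt
    · have h := coeff_le_coeff_indicatorPoly_mul (i := j - n)
        (s := Finset.range n ∪ Finset.Ioc (2 * n) (3 * n)) hnn
        (by simp only [Finset.mem_union, Finset.mem_range]; omega) n
      rw [show j - n + n = j by omega] at h
      exact hI1.trans (hMcn.trans (mul_le_mul_of_nonneg_left h hM0))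
    · have h := coeff_le_coeff_indicatorPoly_mul (i := j)
        (s := Finset.range n ∪ Finset.Ioc (2 * n) (3 * n)) hnn
        (by simp only [Finset.mem_union, Finset.mem_Ioc]; omega) 0
      exact hI1.trans (hMc0.trans (mul_le_mul_of_nonneg_left h hM0))
  have h := coeff_mul_nonneg_of_Sset_subset ⟨hnn, hp1⟩ hS key (2 * n)
  rw [hmid p' hdeg, hp'.2] at h
  linarith

theorem stmt_16 (p p' : Polynomial ℝ) (hp : p ∈ Pset) (hp' : p' ∈ Pset)
    (hdeg : p'.degree ≤ p.degree) (h0 : p.coeff 0 ≠ 0) :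
    p = p' ↔ Sset p ⊆ Sset p' := by
  refine ⟨fun h => h ▸ subset_rfl, fun hS => ?_⟩
  exact eq_of_coeff_le_of_eval_one_eq
    (coeff_le_coeff_of_Sset_subset hp hp' (natDegree_le_natDegree hdeg) h0 hS)
    (hp.2.trans hp'.2.symm)
end
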